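/- Let α ≤ β be antichains of subsets of a finite set N, with α < β; let l₀ be the size of the smallest sets of P_{[α,β]}, l_i = l₀ + i, λ_l = {X ∈ P_{[α,β]} | |X| = l}; for χ ⊆ λ_l define χ⁺ = {X ∈ λ_{l+1} | X⁻ ∩ λ_l ⊆ χ}, χ⁺⁺ = (χ⁺)⁺, and for l > l₀, χ⁻ = {Y ∈ λ_{l-1} | Y ∈ X⁻ for some X ∈ χ}. Then the number of elements of the interval satisfies |[α,β]| = Σ_{χ₀ ⊆ λ_{l₀}} Σ_{χ₂ ⊆ χ₀⁺⁺} Σ_{χ₄ ⊆ χ₂⁺⁺} … 2^{|χ₀⁺| − |χ₂⁻| + |χ₂⁺| − |χ₄⁻| + …}, where the nested sum runs over all finite sequences (χ₀, χ₂, χ₄, …) with χ_{2i+2} ⊆ χ_{2i}⁺⁺ for all i (the sequence terminates when the levels λ_{l} are exhausted). -/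

import Mathlib

/-!
Antichains of subsets of a finite universe
(following De Causmaecker & De Wannemacker,
"On the number of antichains of sets in a finite universe").
-/

open scoped Classical

namespace Antichains

variable {V : Type*} [DecidableEq V]

/-- The `max` operator: keep only the non-dominated members of a family of sets. -/
def maxl (S : Finset (Finset V)) : Finset (Finset V) :=
  S.filter fun X => ∀ Y ∈ S, ¬X ⊂ Y

/-- `A` is an antichain of subsets: no two members are in a subset-superset relation. -/
def IsAC (A : Finset (Finset V)) : Prop :=
  ∀ X ∈ A, ∀ Y ∈ A, X ⊆ Y → X = Y

/-- The domination (partial) order on antichains: `acle A B` iff every member of `A`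
is contained in some member of `B`. -/
def acle (A B : Finset (Finset V)) : Prop :=
  ∀ X ∈ A, ∃ Y ∈ B, X ⊆ Y

/-- Strict domination. -/
def aclt (A B : Finset (Finset V)) : Prop :=
  acle A B ∧ ¬acle B A

/-- Join of antichains: `A ∨ B = max (A ∪ B)`. -/
def acjoin (A B : Finset (Finset V)) : Finset (Finset V) :=
  maxl (A ∪ B)

/-- Meet of antichains: `A ∧ B = max {X ∩ Y | X ∈ A, Y ∈ B}`. -/
def acmeet (A B : Finset (Finset V)) : Finset (Finset V) :=
  maxl ((A ×ˢ B).image fun p => p.1 ∩ p.2)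

/-- `X⁻`: the antichain of immediate subsets of `X`. -/
def im (X : Finset V) : Finset (Finset V) :=
  X.image fun x => X.erase x

/-- The interval poset `P_[a,b] = {X | a ∨ {X} ∈ (a,b]}`. -/
noncomputable def iposet [Fintype V] (a b : Finset (Finset V)) : Finset (Finset V) :=
  Finset.univ.filter fun X : Finset V => aclt a (acjoin a {X}) ∧ acle (acjoin a {X}) b

/-- `χ` belongs, as an antichain, to the interval `[a,b]`. -/
def memI (a b χ : Finset (Finset V)) : Prop :=
  IsAC χ ∧ acle a χ ∧ acle χ b

/-- `λ_l`: the sets of size `l` in the interval poset of `[a, b]`. -/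
noncomputable def lam [Fintype V] (a b : Finset (Finset V)) (l : ℕ) :
    Finset (Finset V) :=
  (iposet a b).filter fun X => X.card = l

/-- For `χ ⊆ λ_l`, the set `χ⁺ = {X ∈ λ_{l+1} | X⁻ ∩ λ_l ⊆ χ}`. -/
noncomputable def plusOp [Fintype V] (a b : Finset (Finset V)) (l : ℕ)
    (χ : Finset (Finset V)) : Finset (Finset V) :=
  (lam a b (l + 1)).filter fun X => im X ∩ lam a b l ⊆ χ

/-- For `χ ⊆ λ_{l+1}`, the set `χ⁻ = {Y ∈ λ_l | Y ∈ X⁻ for some X ∈ χ}`. -/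
noncomputable def minusOp [Fintype V] (a b : Finset (Finset V)) (l : ℕ)
    (χ : Finset (Finset V)) : Finset (Finset V) :=
  (lam a b l).filter fun Y => ∃ X ∈ χ, Y ∈ im X

/-- Extension of a finitely indexed level sequence to `ℕ` (by `∅`). -/
def gval {V : Type*} [DecidableEq V] {m : ℕ} (g : Fin m → Finset (Finset V)) (i : ℕ) :
    Finset (Finset V) :=
  if h : i < m then g ⟨i, h⟩ else ∅

/-- `D` is a down-closed subfamily of the family `P`. -/
def IsLowerIn (P D : Finset (Finset V)) : Prop :=
  D ⊆ P ∧ ∀ X ∈ D, ∀ Y ∈ P, Y ⊆ X → Y ∈ D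

/-- The members of `D` of size `l`. -/
def level (D : Finset (Finset V)) (l : ℕ) : Finset (Finset V) :=
  D.filter fun X => X.card = l

lemma mem_level {D : Finset (Finset V)} {l : ℕ} {X : Finset V} :
    X ∈ level D l ↔ X ∈ D ∧ X.card = l := by
  simp [level]

lemma maxl_subset (S : Finset (Finset V)) : maxl S ⊆ S :=
  Finset.filter_subset _ _

lemma isAC_maxl (S : Finset (Finset V)) : IsAC (maxl S) := by
  intro X hX Y hY hXY
  by_contra hne
  exact (Finset.mem_filter.1 hX).2 Y (maxl_subset S hY) (Finset.ssubset_iff_subset_ne.2 ⟨hXY, hne⟩)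

lemma exists_mem_maxl_superset {S : Finset (Finset V)} {X : Finset V} (hX : X ∈ S) :
    ∃ Y ∈ maxl S, X ⊆ Y := by
  obtain ⟨Y, hXY, hY⟩ := S.exists_le_maximal hX
  refine ⟨Y, Finset.mem_filter.2 ⟨hY.prop, fun Z hZ hYZ => ?_⟩, hXY⟩
  exact hYZ.2 (hY.le_of_ge hZ hYZ.1)

lemma acle_maxl_iff {S B : Finset (Finset V)} :
    acle (maxl S) B ↔ acle S B := by
  refine ⟨fun h X hX => ?_, fun h X hX => h X (maxl_subset S hX)⟩
  obtain ⟨Y, hY, hXY⟩ := exists_mem_maxl_superset hX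
  obtain ⟨Z, hZ, hYZ⟩ := h Y hY
  exact ⟨Z, hZ, hXY.trans hYZ⟩

lemma maxl_eq_of_isAC {S C : Finset (Finset V)} (hC : IsAC C) (hCS : C ⊆ S) (hSC : acle S C) :
    maxl S = C := by
  ext X
  constructor
  · intro hX
    obtain ⟨Y, hY, hXY⟩ := hSC X (maxl_subset S hX)
    obtain ⟨Z, hZ, hYZ⟩ := exists_mem_maxl_superset (hCS hY)
    have := isAC_maxl S X hX Z hZ (hXY.trans hYZ)
    subst this
    rwa [Finset.Subset.antisymm hXY hYZ]
  · intro hX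
    refine Finset.mem_filter.2 ⟨hCS hX, fun Y hY hXY => ?_⟩
    obtain ⟨Z, hZ, hYZ⟩ := hSC Y hY
    have := hC X hX Z hZ (hXY.1.trans hYZ)
    subst this
    exact hXY.2 hYZ

/-- The interval poset consists of the sets dominated by `b` but not by `a`. -/
lemma mem_iposet [Fintype V] {a b : Finset (Finset V)} (hab : acle a b) {X : Finset V} :
    X ∈ iposet a b ↔ (∀ Y ∈ a, ¬X ⊆ Y) ∧ ∃ Y ∈ b, X ⊆ Y := by
  have hle : acle a (acjoin a {X}) := fun Y hY =>
    exists_mem_maxl_superset (Finset.mem_union_left _ hY)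
  have key : ∀ c, acle a c → (acle (acjoin a {X}) c ↔ ∃ Y ∈ c, X ⊆ Y) := by
    intro c hc
    rw [acjoin, acle_maxl_iff]
    constructor
    · exact fun h => h X (by simp)
    · intro h Y hY
      rcases Finset.mem_union.1 hY with hY | hY
      · exact hc Y hY
      · rwa [Finset.mem_singleton.1 hY]
  have haa : acle a a := fun Y hY => ⟨Y, hY, subset_rfl⟩
  rw [iposet, Finset.mem_filter, aclt, key b hab, key a haa]
  simp [hle]

lemma mem_iposet_of_subset [Fintype V] {a b : Finset (Finset V)} (hab : acle a b)
    {X Y Z : Finset V} (hX : X ∈ iposet a b) (hZ : Z ∈ iposet a b) (hXY : X ⊆ Y) (hYZ : Y ⊆ Z) :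
    Y ∈ iposet a b := by
  rw [mem_iposet hab] at *
  obtain ⟨B, hB, hZB⟩ := hZ.2
  exact ⟨fun A hA hYA => hX.1 A hA (hXY.trans hYA), B, hB, hYZ.trans hZB⟩

/-- The antichains of the interval `[a, b]` correspond to the down-closed subfamilies of its
interval poset. -/
lemma card_memI_eq [Fintype V] {a b : Finset (Finset V)} (hab : acle a b) :
    (Finset.univ.filter fun χ : Finset (Finset V) => memI a b χ).card =
      (Finset.univ.filter fun D : Finset (Finset V) => IsLowerIn (iposet a b) D).card := by
  refine Finset.card_nbij' (fun χ => (iposet a b).filter fun X => ∃ Z ∈ χ, X ⊆ Z)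
    (fun D => maxl (a ∪ D)) ?_ ?_ ?_ ?_
  · intro χ _
    simp only [Finset.coe_filter, Finset.mem_univ, true_and, Set.mem_ofPred_eq]
    refine ⟨Finset.filter_subset _ _, fun X hX Y hY hYX => ?_⟩
    obtain ⟨-, Z, hZ, hXZ⟩ := Finset.mem_filter.1 hX
    exact Finset.mem_filter.2 ⟨hY, Z, hZ, hYX.trans hXZ⟩
  · intro D hD
    simp only [Finset.coe_filter, Finset.mem_univ, true_and, Set.mem_ofPred_eq] at hD ⊢
    refine ⟨isAC_maxl _, fun X hX => exists_mem_maxl_superset (Finset.mem_union_left _ hX),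
      acle_maxl_iff.2 fun X hX => ?_⟩
    rcases Finset.mem_union.1 hX with hX | hX
    · exact hab X hX
    · exact ((mem_iposet hab).1 (hD.1 hX)).2
  · intro χ hχ
    simp only [Finset.coe_filter, Finset.mem_univ, true_and, Set.mem_ofPred_eq] at hχ
    obtain ⟨hac, haχ, hχb⟩ := hχ
    refine maxl_eq_of_isAC hac (fun X hX => ?_) (fun X hX => ?_)
    · rw [Finset.mem_union]
      by_cases h : ∃ A ∈ a, X ⊆ A
      · obtain ⟨A, hA, hXA⟩ := h
        obtain ⟨Z, hZ, hAZ⟩ := haχ A hA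
        have := hac X hX Z hZ (hXA.trans hAZ)
        subst this
        rw [Finset.Subset.antisymm hXA hAZ]
        exact Or.inl hA
      · push Not at h
        exact Or.inr (Finset.mem_filter.2
          ⟨(mem_iposet hab).2 ⟨h, hχb X hX⟩, X, hX, subset_rfl⟩)
    · rcases Finset.mem_union.1 hX with hX | hX
      · exact haχ X hX
      · exact (Finset.mem_filter.1 hX).2
  · intro D hD
    simp only [Finset.coe_filter, Finset.mem_univ, true_and, Set.mem_ofPred_eq] at hD
    ext X
    simp only [Finset.mem_filter]
    constructor
    · rintro ⟨hX, Z, hZ, hXZ⟩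
      rcases Finset.mem_union.1 (maxl_subset _ hZ) with hZ | hZ
      · exact absurd hXZ (((mem_iposet hab).1 hX).1 Z hZ)
      · exact hD.2 Z hZ X hX hXZ
    · exact fun hX => ⟨hD.1 hX, exists_mem_maxl_superset (Finset.mem_union_right _ hX)⟩

lemma mem_im {X Y : Finset V} : Y ∈ im X ↔ Y ⊆ X ∧ Y.card + 1 = X.card := by
  simp only [im, Finset.mem_image]
  constructor
  · rintro ⟨x, hx, rfl⟩
    exact ⟨Finset.erase_subset _ _, Finset.card_erase_add_one hx⟩
  · rintro ⟨hYX, hc⟩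
    obtain ⟨x, hx, rfl⟩ := (Finset.covBy_iff_exists_insert).1
      (Finset.covBy_iff_card_sdiff_eq_one.2 ⟨hYX, by
        rw [Finset.card_sdiff_of_subset hYX]; omega⟩)
    exact ⟨x, Finset.mem_insert_self _ _, Finset.erase_insert hx⟩

/-- In an interval poset, closure under immediate subsets is enough for down-closure. -/
lemma isLowerIn_iposet_iff [Fintype V] {a b : Finset (Finset V)} (hab : acle a b)
    {D : Finset (Finset V)} :
    IsLowerIn (iposet a b) D ↔
      D ⊆ iposet a b ∧ ∀ X ∈ D, ∀ Y ∈ iposet a b, Y ∈ im X → Y ∈ D := by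
  refine and_congr_right fun hD => ⟨fun h X hX Y hY hYX => h X hX Y hY (mem_im.1 hYX).1, fun h => ?_⟩
  intro X
  induction X using Finset.strongInduction with
  | H X ih =>
    intro hX Y hY hYX
    by_cases hne : X ⊆ Y
    · rwa [Finset.Subset.antisymm hYX hne]
    · obtain ⟨x, hxX, hxY⟩ := Finset.not_subset.1 hne
      have hYe : Y ⊆ X.erase x := Finset.subset_erase.2 ⟨hYX, hxY⟩
      have he := mem_iposet_of_subset hab hY (hD hX) hYe (Finset.erase_subset _ _)
      exact ih _ (Finset.erase_ssubset hxX)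
        (h X hX _ he (Finset.mem_image_of_mem _ hxX)) Y hY hYe

lemma lam_eq_level [Fintype V] (a b : Finset (Finset V)) (l : ℕ) :
    lam a b l = level (iposet a b) l := by
  ext X
  simp [lam, level]

lemma mem_plusOp [Fintype V] {a b χ : Finset (Finset V)} {l : ℕ} {X : Finset V} :
    X ∈ plusOp a b l χ ↔
      (X ∈ iposet a b ∧ X.card = l + 1) ∧ ∀ Y ∈ iposet a b, Y ∈ im X → Y ∈ χ := by
  simp only [plusOp, Finset.mem_filter, lam_eq_level, mem_level, Finset.subset_iff,
    Finset.mem_inter]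
  refine and_congr_right fun hX => ⟨fun h Y hY hYX => h ⟨hYX, hY, ?_⟩, fun h Y hY => h Y hY.2.1 hY.1⟩
  have := (mem_im.1 hYX).2
  omega

lemma mem_minusOp [Fintype V] {a b χ : Finset (Finset V)} {l : ℕ} {Y : Finset V} :
    Y ∈ minusOp a b l χ ↔ (Y ∈ iposet a b ∧ Y.card = l) ∧ ∃ X ∈ χ, Y ∈ im X := by
  simp only [minusOp, Finset.mem_filter, lam_eq_level, mem_level]

/-- `χ ↦ χ⁻` and `χ ↦ χ⁺` form a Galois connection between consecutive levels. -/
lemma minusOp_subset_iff [Fintype V] {a b χ ψ : Finset (Finset V)} {l : ℕ}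
    (hχ : χ ⊆ lam a b (l + 1)) : minusOp a b l χ ⊆ ψ ↔ χ ⊆ plusOp a b l ψ := by
  simp only [Finset.subset_iff, lam_eq_level, mem_level, mem_minusOp, mem_plusOp] at *
  constructor
  · exact fun h X hX => ⟨hχ hX, fun Y hY hYX => h ⟨⟨hY, by
      have := (mem_im.1 hYX).2
      have := (hχ hX).2
      omega⟩, X, hX, hYX⟩⟩
  · rintro h Y ⟨⟨hY, -⟩, X, hX, hYX⟩
    exact (h hX).2 Y hY hYX

lemma plusOp_subset_lam [Fintype V] (a b : Finset (Finset V)) (l : ℕ) (χ : Finset (Finset V)) :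
    plusOp a b l χ ⊆ lam a b (l + 1) :=
  Finset.filter_subset _ _

lemma plusOp_mono [Fintype V] {a b χ ψ : Finset (Finset V)} {l : ℕ} (h : χ ⊆ ψ) :
    plusOp a b l χ ⊆ plusOp a b l ψ := by
  intro X
  simp only [mem_plusOp]
  exact fun hX => ⟨hX.1, fun Y hY hYX => h (hX.2 Y hY hYX)⟩

lemma level_succ_subset_plusOp [Fintype V] {a b D : Finset (Finset V)}
    (hD : IsLowerIn (iposet a b) D) (l : ℕ) :
    level D (l + 1) ⊆ plusOp a b l (level D l) := by
  intro X hX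
  rw [mem_level] at hX
  refine mem_plusOp.2 ⟨⟨hD.1 hX.1, hX.2⟩, fun Y hY hYX => mem_level.2 ?_⟩
  have h := mem_im.1 hYX
  exact ⟨hD.2 X hX.1 Y hY h.1, by omega⟩

lemma gval_coe {m : ℕ} (g : Fin m → Finset (Finset V)) (i : Fin m) : gval g i = g i := by
  simp [gval]

lemma gval_level [Fintype V] (D : Finset (Finset V)) {e : ℕ → ℕ} (he : ∀ i, i ≤ e i) (i : ℕ) :
    gval (fun j : Fin (Fintype.card V + 1) => level D (e j)) i = level D (e i) := by
  unfold gval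
  split_ifs with h
  · rfl
  · symm
    rw [Finset.eq_empty_iff_forall_notMem]
    intro X hX
    have := (mem_level.1 hX).2
    have := X.card_le_univ
    have := he i
    omega

/-- The down-closed subfamilies with prescribed even levels `g` are obtained by choosing every
odd level between `χ₂ᵢ₊₂⁻` and `χ₂ᵢ⁺`. -/
lemma card_isLowerIn_fiber [Fintype V] {a b : Finset (Finset V)} (hab : acle a b) {l₀ : ℕ}
    (hl₀ : ∀ X ∈ iposet a b, l₀ ≤ X.card) (g : Fin (Fintype.card V + 1) → Finset (Finset V))
    (hg₀ : gval g 0 ⊆ lam a b l₀)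
    (hg : ∀ i : ℕ, gval g (i + 1) ⊆
      plusOp a b (l₀ + 2 * i + 1) (plusOp a b (l₀ + 2 * i) (gval g i))) :
    (Finset.univ.filter fun D : Finset (Finset V) => IsLowerIn (iposet a b) D ∧
      (fun i : Fin (Fintype.card V + 1) => level D (l₀ + 2 * i)) = g).card =
    (Fintype.piFinset fun i : Fin (Fintype.card V + 1) =>
      Finset.Icc (minusOp a b (l₀ + 2 * i + 1) (gval g (i + 1)))
        (plusOp a b (l₀ + 2 * i) (gval g i))).card := by
  have hglam : ∀ i, gval g i ⊆ lam a b (l₀ + 2 * i) := by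
    rintro (_ | i)
    · exact hg₀
    · exact (hg i).trans (plusOp_subset_lam _ _ _ _)
  have hge : ∀ i X, X ∈ gval g i → X ∈ iposet a b ∧ X.card = l₀ + 2 * i := fun i X hX => by
    simpa [lam_eq_level, mem_level] using hglam i hX
  set S := Fintype.piFinset fun i : Fin (Fintype.card V + 1) =>
    Finset.Icc (minusOp a b (l₀ + 2 * i + 1) (gval g (i + 1)))
      (plusOp a b (l₀ + 2 * i) (gval g i)) with hS
  have hlower : ∀ h ∈ S, ∀ i, minusOp a b (l₀ + 2 * i + 1) (gval g (i + 1)) ⊆ gval h i := by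
    intro h hh i Y hY
    by_cases hi : i < Fintype.card V + 1
    · have := (Finset.mem_Icc.1 (Fintype.mem_piFinset.1 hh ⟨i, hi⟩)).1 hY
      rwa [← gval_coe h] at this
    · obtain ⟨-, X, hX, -⟩ := mem_minusOp.1 hY
      have hi' : ¬i + 1 < Fintype.card V + 1 := by omega
      simp [gval, hi'] at hX
  have hupper : ∀ h ∈ S, ∀ i, gval h i ⊆ plusOp a b (l₀ + 2 * i) (gval g i) := by
    intro h hh i
    by_cases hi : i < Fintype.card V + 1
    · have := (Finset.mem_Icc.1 (Fintype.mem_piFinset.1 hh ⟨i, hi⟩)).2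
      rwa [← gval_coe h] at this
    · simp [gval, hi]
  have hhe : ∀ h ∈ S, ∀ i X, X ∈ gval h i → X ∈ iposet a b ∧ X.card = l₀ + 2 * i + 1 :=
    fun h hh i X hX => (mem_plusOp.1 (hupper h hh i hX)).1
  have heven : ∀ h ∈ S, ∀ i, level ((iposet a b).filter fun X =>
      ∃ i, X ∈ gval g i ∨ X ∈ gval h i) (l₀ + 2 * i) = gval g i := by
    intro h hh i
    ext X
    rw [mem_level, Finset.mem_filter]
    constructor
    · rintro ⟨⟨-, j, hX | hX⟩, hc⟩
      · have hj := (hge j X hX).2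
        rwa [show i = j by omega]
      · have hj := (hhe h hh j X hX).2
        omega
    · exact fun hX => ⟨⟨(hge i X hX).1, i, Or.inl hX⟩, (hge i X hX).2⟩
  have hodd : ∀ h ∈ S, ∀ i, level ((iposet a b).filter fun X =>
      ∃ i, X ∈ gval g i ∨ X ∈ gval h i) (l₀ + 2 * i + 1) = gval h i := by
    intro h hh i
    ext X
    rw [mem_level, Finset.mem_filter]
    constructor
    · rintro ⟨⟨-, j, hX | hX⟩, hc⟩
      · have hj := (hge j X hX).2
        omega
      · have hj := (hhe h hh j X hX).2
        rwa [show i = j by omega]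
    · exact fun hX => ⟨⟨(hhe h hh i X hX).1, i, Or.inr hX⟩, (hhe h hh i X hX).2⟩
  refine Finset.card_nbij' (fun D i => level D (l₀ + 2 * i + 1))
    (fun h => (iposet a b).filter fun X => ∃ i, X ∈ gval g i ∨ X ∈ gval h i) ?_ ?_ ?_ ?_
  · intro D hD
    simp only [Finset.coe_filter, Finset.mem_univ, true_and, Set.mem_ofPred_eq] at hD
    obtain ⟨hD, rfl⟩ := hD
    have hgv := gval_level D (e := fun i => l₀ + 2 * i) (fun i => by omega)
    simp only [hS, Finset.mem_coe, Fintype.mem_piFinset, Finset.mem_Icc]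
    intro i
    refine ⟨(minusOp_subset_iff (hglam (i + 1))).2 ?_, ?_⟩
    · rw [hgv]
      exact level_succ_subset_plusOp hD _
    · rw [hgv]
      exact level_succ_subset_plusOp hD _
  · intro h hh
    replace hh : h ∈ S := hh
    simp only [Finset.coe_filter, Finset.mem_univ, true_and, Set.mem_ofPred_eq]
    refine ⟨(isLowerIn_iposet_iff hab).2 ⟨Finset.filter_subset _ _, ?_⟩, ?_⟩
    · intro X hX Y hY hYX
      obtain ⟨-, i, hX | hX⟩ := Finset.mem_filter.1 hX
      · have hcX := (hge i X hX).2
        have hcY := hl₀ Y hY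
        have hc := (mem_im.1 hYX).2
        obtain _ | i := i
        · omega
        · exact Finset.mem_filter.2 ⟨hY, i, Or.inr (hlower h hh i
            (mem_minusOp.2 ⟨⟨hY, by omega⟩, X, hX, hYX⟩))⟩
      · exact Finset.mem_filter.2
          ⟨hY, i, Or.inl ((mem_plusOp.1 (hupper h hh i hX)).2 Y hY hYX)⟩
    · funext i
      rw [heven h hh, gval_coe]
  · intro D hD
    simp only [Finset.coe_filter, Finset.mem_univ, true_and, Set.mem_ofPred_eq] at hD
    obtain ⟨hD, rfl⟩ := hD
    have hgv := gval_level D (e := fun i => l₀ + 2 * i) (fun i => by omega)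
    have hhv := gval_level D (e := fun i => l₀ + 2 * i + 1) (fun i => by omega)
    ext X
    simp only [hgv, hhv, mem_level, Finset.mem_filter]
    constructor
    · rintro ⟨-, i, h | h⟩ <;> exact h.1
    · intro hX
      have := hl₀ X (hD.1 hX)
      refine ⟨hD.1 hX, (X.card - l₀) / 2, ?_⟩
      simp only [hX, true_and]
      omega
  · intro h hh
    funext i
    exact (hodd h hh i).trans (gval_coe h i)

/-- Theorem 3, formula (2), of the paper.  For antichains `a < b`,
with `l₀` the size of the smallest sets of `P_[a,b]`, the size of the interval `[a, b]`
is obtained by summing, over all sequences `χ₀ ⊆ λ_{l₀}`, `χ₂ ⊆ χ₀⁺⁺`, `χ₄ ⊆ χ₂⁺⁺`, …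
of even-level choices (the sequence terminating when the levels are exhausted), the
powers `2^{|χ₀⁺| - |χ₂⁻| + |χ₂⁺| - |χ₄⁻| + ⋯}`. -/
theorem statement12 {V : Type*} [DecidableEq V] [Fintype V] (a b : Finset (Finset V))
    (ha : IsAC a) (hb : IsAC b) (hab : aclt a b) (l₀ : ℕ)
    (hl₀ : (∃ X ∈ iposet a b, X.card = l₀) ∧ ∀ X ∈ iposet a b, l₀ ≤ X.card) :
    (Finset.univ.filter fun χ : Finset (Finset V) => memI a b χ).card =
      ∑ g ∈ Finset.univ.filter
          (fun g : Fin (Fintype.card V + 1) → Finset (Finset V) =>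
            gval g 0 ⊆ lam a b l₀ ∧
            ∀ i : ℕ, gval g (i + 1) ⊆
              plusOp a b (l₀ + 2 * i + 1) (plusOp a b (l₀ + 2 * i) (gval g i))),
        2 ^ (∑ i ∈ Finset.range (Fintype.card V + 1),
          ((plusOp a b (l₀ + 2 * i) (gval g i)).card -
            (minusOp a b (l₀ + 2 * i + 1) (gval g (i + 1))).card)) := by
  have hle := hab.1
  rw [card_memI_eq hle, Finset.card_eq_sum_card_fiberwise
    (f := fun D (i : Fin (Fintype.card V + 1)) => level D (l₀ + 2 * i))
    (t := Finset.univ.filter fun g : Fin (Fintype.card V + 1) → Finset (Finset V) =>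
      gval g 0 ⊆ lam a b l₀ ∧ ∀ i : ℕ, gval g (i + 1) ⊆
        plusOp a b (l₀ + 2 * i + 1) (plusOp a b (l₀ + 2 * i) (gval g i)))]
  · refine Finset.sum_congr rfl fun g hg => ?_
    obtain ⟨hg₀, hg⟩ := (Finset.mem_filter.1 hg).2
    rw [Finset.filter_filter, card_isLowerIn_fiber hle hl₀.2 g hg₀ hg, Fintype.card_piFinset,
      Finset.sum_range, ← Finset.prod_pow_eq_pow_sum]
    refine Finset.prod_congr rfl fun i _ => Finset.card_Icc_finset ?_
    exact (minusOp_subset_iff ((hg i).trans (plusOp_subset_lam _ _ _ _))).2 (hg i)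
  · intro D hD
    simp only [Finset.coe_filter, Finset.mem_univ, true_and, Set.mem_ofPred_eq] at hD ⊢
    have hgv := gval_level D (e := fun i => l₀ + 2 * i) (fun i => by omega)
    simp only [hgv]
    refine ⟨?_, fun i => (level_succ_subset_plusOp hD _).trans
      (plusOp_mono (level_succ_subset_plusOp hD _))⟩
    rw [lam_eq_level]
    exact Finset.filter_subset_filter _ hD.1

end Antichains
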